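/- For every set X of exactly 4 points in the Euclidean plane in general position, the flip graph of plane spanning trees G_X^S contains a 2-rainbow cycle; and for every set X of exactly 5 points in the Euclidean plane in general position and every r ∈ {2,3,4}, the flip graph G_X^S contains an r-rainbow cycle. -/

import Mathlib

/-! Rainbow cycles in the flip graph of plane spanning trees on a point set
`X` in the Euclidean plane in general position. -/

/-- A finite point set in the plane is in general position if no three of its
points are collinear. -/
def GeneralPosition (X : Finset (ℝ × ℝ)) : Prop :=
  ∀ p ∈ X, ∀ q ∈ X, ∀ r ∈ X, p ≠ q → p ≠ r → q ≠ r →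
    ¬ Collinear ℝ ({p, q, r} : Set (ℝ × ℝ))

/-- The closed straight-line segment realizing an unordered pair of points. -/
def seg : Sym2 (ℝ × ℝ) → Set (ℝ × ℝ) :=
  Sym2.lift ⟨fun p q => segment ℝ p q, fun p q => segment_symm ℝ p q⟩

/-- `T` is a plane spanning tree on the finite point set `X`: its edges are
unordered pairs of distinct points of `X`, it is connected and has `|X| - 1`
edges (hence is a spanning tree), and the closed segments realizing two
distinct edges intersect in at most a common endpoint. -/
def IsPlaneSpanningTree (X : Finset (ℝ × ℝ)) (T : Finset (Sym2 (ℝ × ℝ))) : Prop :=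
  (∀ e ∈ T, ∃ p q : ℝ × ℝ, e = s(p, q) ∧ p ≠ q ∧ p ∈ X ∧ q ∈ X) ∧
  T.card = X.card - 1 ∧
  (∀ p ∈ X, ∀ q ∈ X, Relation.ReflTransGen (fun a b => s(a, b) ∈ T) p q) ∧
  (∀ e ∈ T, ∀ f ∈ T, e ≠ f → ∀ x ∈ seg e, x ∈ seg f → x ∈ e ∧ x ∈ f)

/-- An `r`-rainbow cycle of length `L` in the flip graph `G_X^S` of plane
spanning trees on `X`, encoded as an `L`-periodic sequence `V` of plane
spanning trees: consecutive trees differ in a flip (removing one edge `e` and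
inserting another edge `f`, which is the label of the arc), no tree is visited
twice within a period, and every pair of distinct points of `X` appears as an
arc label (i.e. enters the tree) exactly `r` times per period. -/
def IsRainbowCycleS (X : Finset (ℝ × ℝ)) (r L : ℕ)
    (V : ℕ → Finset (Sym2 (ℝ × ℝ))) : Prop :=
  0 < L ∧
  (∀ i, V (i + L) = V i) ∧
  (∀ i < L, ∀ j < L, V i = V j → i = j) ∧
  (∀ i, IsPlaneSpanningTree X (V i)) ∧
  (∀ i, ∃ e f, e ∈ V i ∧ f ∉ V i ∧ V (i + 1) = insert f ((V i).erase e)) ∧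
  (∀ p ∈ X, ∀ q ∈ X, p ≠ q →
    ((Finset.range L).filter (fun i => s(p, q) ∈ V (i + 1) ∧ s(p, q) ∉ V i)).card = r)

/-! ### Orientations -/

/-- Twice the signed area of the triangle `a b c`. -/
def orient (a b c : ℝ × ℝ) : ℝ :=
  (b.1 - a.1) * (c.2 - a.2) - (b.2 - a.2) * (c.1 - a.1)

theorem orient_swap_left (a b c : ℝ × ℝ) : orient b a c = -orient a b c := by
  unfold orient; ring

theorem orient_swap_right (a b c : ℝ × ℝ) : orient a c b = -orient a b c := by
  unfold orient; ring

theorem orient_ne_zero_of_not_collinear {a b c : ℝ × ℝ} (hab : a ≠ b)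
    (h : ¬ Collinear ℝ ({a, b, c} : Set (ℝ × ℝ))) : orient a b c ≠ 0 := by
  intro h0
  apply h
  rw [collinear_iff_of_mem (p₀ := a) (by simp)]
  refine ⟨b - a, ?_⟩
  obtain ⟨a1, a2⟩ := a
  obtain ⟨b1, b2⟩ := b
  obtain ⟨c1, c2⟩ := c
  simp only [orient] at h0
  suffices hc : ∃ r : ℝ, (c1, c2) = r • ((b1, b2) - (a1, a2) : ℝ × ℝ) +ᵥ ((a1, a2) : ℝ × ℝ) by
    intro p hp
    simp only [Set.mem_insert_iff, Set.mem_singleton_iff] at hp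
    rcases hp with rfl | rfl | rfl
    · exact ⟨0, by simp⟩
    · exact ⟨1, by simp⟩
    · exact hc
  by_cases h1 : b1 - a1 = 0
  · have h2 : b2 - a2 ≠ 0 := by
      intro h2
      exact hab (Prod.ext (by simp only; linarith) (by simp only; linarith))
    refine ⟨(c2 - a2) / (b2 - a2), ?_⟩
    have hc : c1 - a1 = 0 := by
      rw [h1, zero_mul, zero_sub, neg_eq_zero] at h0
      exact (mul_eq_zero.1 h0).resolve_left h2
    ext
    · simp [h1]; linarith
    · simp; field_simp; ring
  · refine ⟨(c1 - a1) / (b1 - a1), ?_⟩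
    ext
    · simp; field_simp; ring
    · simp; field_simp; linarith

theorem orient_eq_zero_of_mem_segment {a b x : ℝ × ℝ} (hx : x ∈ segment ℝ a b) :
    orient a b x = 0 := by
  obtain ⟨s, t, -, -, hst, rfl⟩ := hx
  obtain rfl : s = 1 - t := by linarith
  simp [orient]; ring

theorem orient_combo (a b c d : ℝ × ℝ) {s t : ℝ} (hst : s + t = 1) :
    orient a b (s • c + t • d) = s * orient a b c + t * orient a b d := by
  obtain rfl : s = 1 - t := by linarith
  simp [orient]; ring

/-- If `c` and `d` are strictly on the same side of the line `a b`, then the segments `a b` and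
`c d` are disjoint. -/
theorem disjoint_segment_of_same_side {a b c d : ℝ × ℝ}
    (h : 0 < orient a b c * orient a b d) : Disjoint (segment ℝ a b) (segment ℝ c d) := by
  rw [Set.disjoint_left]
  rintro x hx ⟨s, t, hs, ht, hst, rfl⟩
  have h0 := orient_eq_zero_of_mem_segment hx
  rw [orient_combo a b c d hst] at h0
  rcases mul_pos_iff.1 h with ⟨h1, h2⟩ | ⟨h1, h2⟩ <;>
    rcases hs.eq_or_lt with rfl | hs <;> nlinarith [mul_nonneg ht ht]

/-- Two segments with a common endpoint and different directions meet only in that endpoint. -/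
theorem eq_of_mem_segment_of_mem_segment {a b c x : ℝ × ℝ} (h : orient a b c ≠ 0)
    (hb : x ∈ segment ℝ a b) (hc : x ∈ segment ℝ a c) : x = a := by
  have h0 := orient_eq_zero_of_mem_segment hb
  obtain ⟨s, t, -, -, hst, rfl⟩ := hc
  have ha : orient a b a = 0 := by simp [orient]
  rw [orient_combo a b a c hst, ha, mul_zero, zero_add] at h0
  obtain rfl : t = 0 := (mul_eq_zero.1 h0).resolve_right h
  obtain rfl : s = 1 := by linarith
  simp

/-! ### Drawings of the complete graph without more crossings than in convex position -/

/-- The points `p 0, …, p (n - 1)`, in this cyclic order, span a straight-line drawing of the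
complete graph in which only those pairs of edges meet outside a common endpoint that do so for
points in convex position. -/
def IsConvexLike {n : ℕ} (p : Fin n → ℝ × ℝ) : Prop :=
  ∀ i j k l, i < j → k < l → s(i, j) ≠ s(k, l) →
    ¬ (i < k ∧ k < j ∧ j < l) → ¬ (k < i ∧ i < l ∧ l < j) →
    ∀ x ∈ segment ℝ (p i) (p j), x ∈ segment ℝ (p k) (p l) → x ∈ s(p i, p j) ∧ x ∈ s(p k, p l)

/-- With respect to the triple orientations `o`, one of the two lines `a b` and `c d` does not
separate the remaining two points. -/
abbrev Unseparated {α : Type*} (o : α → α → α → Bool) (a b c d : α) : Prop :=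
  o a b c = o a b d ∨ o c d a = o c d b

/-- The combinatorial version of `IsConvexLike` for triple orientations `o` and points in the
cyclic order `σ`. -/
abbrev IsConvexLikeOrder {n : ℕ} (o : Fin n → Fin n → Fin n → Bool) (σ : Fin n → Fin n) : Prop :=
  ∀ i j, i < j → ∀ k, j < k → ∀ l, k < l →
    Unseparated o (σ i) (σ j) (σ k) (σ l) ∧ Unseparated o (σ i) (σ l) (σ j) (σ k)

instance {n : ℕ} (o : Fin n → Fin n → Fin n → Bool) (σ : Fin n → Fin n) :
    Decidable (IsConvexLikeOrder o σ) := inferInstance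

/-- The orientations of the triples of an indexed family of points. -/
noncomputable def orientSign {n : ℕ} (p : Fin n → ℝ × ℝ) (i j k : Fin n) : Bool :=
  decide (0 < orient (p i) (p j) (p k))

/-- An indexed family in general position, stated by means of orientations. -/
def OrientNeZero {n : ℕ} (p : Fin n → ℝ × ℝ) : Prop :=
  ∀ i j k, i ≠ j → i ≠ k → j ≠ k → orient (p i) (p j) (p k) ≠ 0

theorem OrientNeZero.comp {n : ℕ} {p : Fin n → ℝ × ℝ} (h : OrientNeZero p)
    (σ : Equiv.Perm (Fin n)) : OrientNeZero (p ∘ σ) :=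
  fun _ _ _ hij hik hjk =>
    h _ _ _ (σ.injective.ne hij) (σ.injective.ne hik) (σ.injective.ne hjk)

theorem mul_pos_of_decide_eq {x y : ℝ} (hx : x ≠ 0) (hy : y ≠ 0)
    (h : decide (0 < x) = decide (0 < y)) : 0 < x * y := by
  rw [decide_eq_decide] at h
  rcases hx.lt_or_gt with hx | hx
  · exact mul_pos_of_neg_of_neg hx ((not_lt.1 fun hy' => hx.not_gt (h.2 hy')).lt_of_ne hy)
  · exact mul_pos hx (h.1 hx)

theorem Unseparated.disjoint_segment {n : ℕ} {p : Fin n → ℝ × ℝ} (hp : OrientNeZero p)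
    {a b c d : Fin n} (hab : a ≠ b) (hac : a ≠ c) (had : a ≠ d) (hbc : b ≠ c) (hbd : b ≠ d)
    (hcd : c ≠ d) (h : Unseparated (orientSign p) a b c d) :
    Disjoint (segment ℝ (p a) (p b)) (segment ℝ (p c) (p d)) := by
  rcases h with h | h
  · exact disjoint_segment_of_same_side
      (mul_pos_of_decide_eq (hp _ _ _ hab hac hbc) (hp _ _ _ hab had hbd) h)
  · exact (disjoint_segment_of_same_side
      (mul_pos_of_decide_eq (hp _ _ _ hcd hac.symm had.symm)
        (hp _ _ _ hcd hbc.symm hbd.symm) h)).symm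

theorem isConvexLike_of_order {n : ℕ} {p : Fin n → ℝ × ℝ} (hp : OrientNeZero p)
    (h : IsConvexLikeOrder (orientSign p) id) : IsConvexLike p := by
  intro i j k l hij hkl hne h1 h2 x hx hy
  have key : ∀ i j k l, i < j → k < l → i < k → j ≠ k → j ≠ l → ¬ (k < j ∧ j < l) →
      Disjoint (segment ℝ (p i) (p j)) (segment ℝ (p k) (p l)) := by
    intro i j k l hij hkl hik hjk hjl hcr
    rcases lt_or_ge j k with h' | h'
    · exact (h i j hij k h' l hkl).1.disjoint_segment hp (by grind) (by grind) (by grind)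
        (by grind) (by grind) (by grind)
    · have hlj : l < j := by grind
      exact (h i k hik l hkl j hlj).2.disjoint_segment hp (by grind) (by grind) (by grind)
        (by grind) (by grind) (by grind)
  have share : ∀ a b c : Fin n, a ≠ b → a ≠ c → b ≠ c → x ∈ segment ℝ (p a) (p b) →
      x ∈ segment ℝ (p a) (p c) → x = p a :=
    fun a b c hab hac hbc => eq_of_mem_segment_of_mem_segment (hp a b c hab hac hbc)
  by_cases hik : i = k
  · subst hik
    have := share i j l (by grind) (by grind) (by grind) hx hy
    simp [this]
  by_cases hil : i = l
  · subst hil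
    rw [segment_symm] at hy
    have := share i j k (by grind) (by grind) (by grind) hx hy
    simp [this]
  by_cases hjk : j = k
  · subst hjk
    rw [segment_symm] at hx
    have := share j i l (by grind) (by grind) (by grind) hx hy
    simp [this]
  by_cases hjl : j = l
  · subst hjl
    rw [segment_symm] at hx hy
    have := share j i k (by grind) (by grind) (by grind) hx hy
    simp [this]
  exfalso
  rcases lt_or_gt_of_ne hik with h' | h'
  · exact Set.disjoint_left.1 (key i j k l hij hkl h' hjk hjl (by grind)) hx hy
  · exact Set.disjoint_left.1 (key k l i j hkl hij h' (by grind) (by grind) (by grind)) hy hx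

/-! ### Orientations of points sorted by abscissa -/

/-- Monotonicity of the orientations of the triples of any four points sorted by abscissa: the
signs of `ijk, ijl, ikl, jkl` change at most once. -/
abbrev IsSignotope {n : ℕ} (o : Fin n → Fin n → Fin n → Bool) : Prop :=
  ∀ i j, i < j → ∀ k, j < k → ∀ l, k < l →
    (o i j k = o i k l → o i j l = o i k l) ∧ (o i j k = o j k l → o i j l = o j k l) ∧
      (o i j k = o j k l → o i k l = o j k l) ∧ (o i j l = o j k l → o i k l = o j k l)

instance {n : ℕ} (o : Fin n → Fin n → Fin n → Bool) : Decidable (IsSignotope o) := inferInstance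

theorem decide_pos_eq_of_three_term {u v w α β γ : ℝ} (hu : u ≠ 0) (hw : w ≠ 0)
    (hα : 0 ≤ α) (hβ : 0 ≤ β) (hγ : 0 ≤ γ) (hne : α ≠ 0 ∨ γ ≠ 0)
    (h : u * α - v * β + w * γ = 0) (huw : decide (0 < u) = decide (0 < w)) :
    decide (0 < v) = decide (0 < w) := by
  rw [decide_eq_decide] at huw ⊢
  have hαγ : 0 < α + γ := by
    rcases hne with h | h <;> positivity
  rcases hw.lt_or_gt with hw' | hw'
  · have hu' : u < 0 := (not_lt.1 fun hu' => hw'.not_gt (huw.1 hu')).lt_of_ne hu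
    refine iff_of_false (fun hv' => ?_) hw'.not_gt
    rcases hα.eq_or_lt with rfl | hα
    · nlinarith [mul_nonneg hv'.le hβ]
    · nlinarith [mul_nonneg hv'.le hβ]
  · have hu' := huw.2 hw'
    refine iff_of_true (not_le.1 fun hv' => ?_) hw'
    rcases hα.eq_or_lt with rfl | hα
    · nlinarith [mul_nonneg (neg_nonneg.2 hv') hβ]
    · nlinarith [mul_nonneg (neg_nonneg.2 hv') hβ]

theorem isSignotope_orientSign {n : ℕ} {p : Fin n → ℝ × ℝ} (hp : OrientNeZero p)
    (hmono : Monotone fun i => (p i).1) : IsSignotope (orientSign p) := by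
  intro i j hij k hjk l hkl
  have hab : (p i).1 ≤ (p j).1 := hmono hij.le
  have hbc : (p j).1 ≤ (p k).1 := hmono hjk.le
  have hcd : (p k).1 ≤ (p l).1 := hmono hkl.le
  have abc := hp i j k (by grind) (by grind) (by grind)
  have abd := hp i j l (by grind) (by grind) (by grind)
  have acd := hp i k l (by grind) (by grind) (by grind)
  have bcd := hp j k l (by grind) (by grind) (by grind)
  have vert : ∀ a b c : ℝ × ℝ, orient a b c ≠ 0 → a.1 = b.1 → b.1 = c.1 → False := by
    intro a b c h h1 h2
    apply h
    simp [orient, ← h2, ← h1]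
  refine ⟨decide_pos_eq_of_three_term abc acd (α := (p l).1 - (p i).1)
      (β := (p k).1 - (p i).1) (γ := (p j).1 - (p i).1) (by linarith) (by linarith) (by linarith)
      ?_ (by unfold orient; ring),
    decide_pos_eq_of_three_term abc bcd (α := (p l).1 - (p j).1)
      (β := (p k).1 - (p j).1) (γ := (p j).1 - (p i).1) (by linarith) (by linarith) (by linarith)
      ?_ (by unfold orient; ring),
    decide_pos_eq_of_three_term abc bcd (α := (p l).1 - (p k).1)
      (β := (p k).1 - (p j).1) (γ := (p k).1 - (p i).1) (by linarith) (by linarith) (by linarith)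
      ?_ (by unfold orient; ring),
    decide_pos_eq_of_three_term abd bcd (α := (p l).1 - (p k).1)
      (β := (p l).1 - (p j).1) (γ := (p l).1 - (p i).1) (by linarith) (by linarith) (by linarith)
      ?_ (by unfold orient; ring)⟩ <;>
  · by_contra! hcon
    exact vert _ _ _ abc (by linarith) (by linarith)

/-- The orientation of an arbitrary triple, computed from those of the increasing triples by
antisymmetry. -/
def extendSign {n : ℕ} (o : Fin n → Fin n → Fin n → Bool) (i j k : Fin n) : Bool :=
  if i < j then if j < k then o i j k else if i < k then !o i k j else o k i j
  else if i < k then !o j i k else if j < k then o j k i else !o k j i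

theorem extendSign_orientSign {n : ℕ} {p : Fin n → ℝ × ℝ} (hp : OrientNeZero p) {i j k : Fin n}
    (hij : i ≠ j) (hik : i ≠ k) (hjk : j ≠ k) :
    extendSign (orientSign p) i j k = orientSign p i j k := by
  have neg : ∀ x : ℝ, x ≠ 0 → (!decide (0 < x)) = decide (0 < -x) := by
    intro x hx
    rcases hx.lt_or_gt with h | h <;> simp [h, h.not_gt]
  have swapl : ∀ a b c : Fin n, a ≠ b → a ≠ c → b ≠ c →
      (!orientSign p a b c) = orientSign p b a c := fun a b c h1 h2 h3 => by
    rw [orientSign, orientSign, neg _ (hp a b c h1 h2 h3), orient_swap_left (p a)]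
  have swapr : ∀ a b c : Fin n, a ≠ b → a ≠ c → b ≠ c →
      (!orientSign p a b c) = orientSign p a c b := fun a b c h1 h2 h3 => by
    rw [orientSign, orientSign, neg _ (hp a b c h1 h2 h3), orient_swap_right (p a) (p b)]
  unfold extendSign
  grind

/-- The rank of an increasing triple in the colexicographic order. -/
def colexRank {n : ℕ} (i j k : Fin n) : ℕ :=
  (i : ℕ) + (j : ℕ).choose 2 + (k : ℕ).choose 3

/-- The orientations of increasing triples given by the binary digits of a number. -/
def signOfBits (n N : ℕ) (i j k : Fin n) : Bool :=
  N.testBit (colexRank i j k)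

theorem exists_signOfBits {n m : ℕ}
    (hlt : ∀ i j : Fin n, i < j → ∀ k, j < k → colexRank i j k < m)
    (unrank : ℕ → Fin n × Fin n × Fin n)
    (hunrank : ∀ i j : Fin n, i < j → ∀ k, j < k → unrank (colexRank i j k) = (i, j, k))
    (o : Fin n → Fin n → Fin n → Bool) :
    ∃ N < 2 ^ m, ∀ i j, i < j → ∀ k, j < k → signOfBits n N i j k = o i j k := by
  classical
  refine ⟨Nat.ofBits (n := m) fun t => decide (∃ i j k, i < j ∧ j < k ∧
    colexRank i j k = t ∧ o i j k = true), Nat.ofBits_lt_two_pow _, ?_⟩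
  intro i j hij k hjk
  rw [signOfBits, Nat.testBit_ofBits_lt _ _ (hlt i j hij k hjk), Bool.eq_iff_iff,
    decide_eq_true_iff]
  constructor
  · rintro ⟨i', j', k', hij', hjk', he, ho⟩
    have h := hunrank i' j' hij' k' hjk'
    rw [he, hunrank i j hij k hjk] at h
    cases h
    exact ho
  · exact fun ho => ⟨i, j, k, hij, hjk, rfl, ho⟩

theorem exists_isConvexLike {n m : ℕ}
    (hlt : ∀ i j : Fin n, i < j → ∀ k, j < k → colexRank i j k < m)
    (unrank : ℕ → Fin n × Fin n × Fin n)
    (hunrank : ∀ i j : Fin n, i < j → ∀ k, j < k → unrank (colexRank i j k) = (i, j, k))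
    (hcomb : ∀ N < 2 ^ m, IsSignotope (signOfBits n N) →
      ∃ σ : Equiv.Perm (Fin n), IsConvexLikeOrder (extendSign (signOfBits n N)) σ)
    {X : Finset (ℝ × ℝ)} (hcard : X.card = n) (hX : GeneralPosition X) :
    ∃ p : Fin n → ℝ × ℝ, p.Injective ∧ (∀ x, x ∈ X ↔ ∃ i, p i = x) ∧ IsConvexLike p := by
  let e : Fin n ≃ X := (X.equivFinOfCardEq hcard).symm
  let τ := Tuple.sort fun i => (e i : ℝ × ℝ).1
  let q : Fin n → ℝ × ℝ := fun i => e (τ i)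
  have hq : q.Injective := Subtype.val_injective.comp (e.injective.comp τ.injective)
  have hqX : ∀ i, q i ∈ X := fun i => (e (τ i)).2
  have hq0 : OrientNeZero q := fun i j k hij hik hjk =>
    orient_ne_zero_of_not_collinear (hq.ne hij) (hX _ (hqX i) _ (hqX j) _ (hqX k)
      (hq.ne hij) (hq.ne hik) (hq.ne hjk))
  have hsig : IsSignotope (orientSign q) :=
    isSignotope_orientSign hq0 (Tuple.monotone_sort fun i => (e i : ℝ × ℝ).1)
  obtain ⟨N, hN, hNo⟩ := exists_signOfBits hlt unrank hunrank (orientSign q)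
  have hanti : ∀ {i j k : Fin n}, i ≠ j → i ≠ k → j ≠ k →
      extendSign (signOfBits n N) i j k = orientSign q i j k := by
    intro i j k hij hik hjk
    rw [← extendSign_orientSign hq0 hij hik hjk]
    unfold extendSign
    grind
  obtain ⟨σ, hσ⟩ := hcomb N hN (by
    intro i j hij k hjk l hkl
    have := hsig i j hij k hjk l hkl
    rwa [hNo i j hij k hjk, hNo i j hij l (hjk.trans hkl), hNo i k (hij.trans hjk) l hkl,
      hNo j k hjk l hkl])
  refine ⟨q ∘ σ, hq.comp σ.injective, fun x => ⟨fun hx => ?_, ?_⟩,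
    isConvexLike_of_order (hq0.comp σ) ?_⟩
  · exact ⟨σ.symm (τ.symm (e.symm ⟨x, hx⟩)), by simp [q]⟩
  · rintro ⟨i, rfl⟩
    exact hqX _
  · intro i j hij k hjk l hkl
    have ne : ∀ {a b : Fin n}, a < b → σ a ≠ σ b := fun h => σ.injective.ne h.ne
    have ne' : ∀ {a b : Fin n}, a < b → σ b ≠ σ a := fun h => σ.injective.ne h.ne'
    have hik := hij.trans hjk
    have hil := hik.trans hkl
    have hjl := hjk.trans hkl
    have := hσ i j hij k hjk l hkl
    simp only [Unseparated] at this ⊢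
    rwa [hanti (ne hij) (ne hik) (ne hjk), hanti (ne hij) (ne hil) (ne hjl),
      hanti (ne hkl) (ne' hik) (ne' hil), hanti (ne hkl) (ne' hjk) (ne' hjl),
      hanti (ne hil) (ne hij) (ne' hjl), hanti (ne hil) (ne hik) (ne' hkl),
      hanti (ne hjk) (ne' hij) (ne' hik), hanti (ne hjk) (ne hjl) (ne hkl)] at this

theorem exists_isConvexLike_four {X : Finset (ℝ × ℝ)} (hcard : X.card = 4)
    (hX : GeneralPosition X) :
    ∃ p : Fin 4 → ℝ × ℝ, p.Injective ∧ (∀ x, x ∈ X ↔ ∃ i, p i = x) ∧ IsConvexLike p :=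
  exists_isConvexLike (m := 4) (by decide +kernel)
    (fun t => [(0, 1, 2), (0, 1, 3), (0, 2, 3), (1, 2, 3)].getD t 0)
    (by decide +kernel) (by decide +kernel) hcard hX

theorem exists_isConvexLike_five {X : Finset (ℝ × ℝ)} (hcard : X.card = 5)
    (hX : GeneralPosition X) :
    ∃ p : Fin 5 → ℝ × ℝ, p.Injective ∧ (∀ x, x ∈ X ↔ ∃ i, p i = x) ∧ IsConvexLike p :=
  exists_isConvexLike (m := 10) (by decide +kernel)
    (fun t => [(0, 1, 2), (0, 1, 3), (0, 2, 3), (1, 2, 3), (0, 1, 4), (0, 2, 4), (1, 2, 4),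
      (0, 3, 4), (1, 3, 4), (2, 3, 4)].getD t 0)
    (by decide +kernel) (by decide +kernel) hcard hX

/-! ### Rainbow cycles for convex position -/

/-- Spanning trees on the cyclically ordered points `0, …, n - 1` without crossings in convex
position. -/
def IsConvexTree {n : ℕ} [NeZero n] (T : Finset (Sym2 (Fin n))) : Prop :=
  (∀ e ∈ T, ¬ e.IsDiag) ∧ T.card = n - 1 ∧
    (∀ j, Relation.ReflTransGen (fun a b => s(a, b) ∈ T) 0 j) ∧
    ∀ i k, i < k → ∀ j, k < j → ∀ l, j < l → s(i, j) ∈ T → s(k, l) ∉ T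

/-- A rainbow cycle of length `L` for convex position. -/
def IsConvexRainbowCycle {n : ℕ} [NeZero n] (r L : ℕ)
    (U : ℕ → Finset (Sym2 (Fin n))) : Prop :=
  0 < L ∧ U L = U 0 ∧ (∀ i < L, ∀ j < L, U i = U j → i = j) ∧
  (∀ i < L, IsConvexTree (U i)) ∧
  (∀ i < L, ∃ e ∈ U i, ∃ f ∈ U (i + 1), f ∉ U i ∧ U (i + 1) = insert f ((U i).erase e)) ∧
  (∀ i j : Fin n, i ≠ j →
    ((Finset.range L).filter fun t => s(i, j) ∈ U (t + 1) ∧ s(i, j) ∉ U t).card = r)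

theorem isPlaneSpanningTree_map {n : ℕ} [NeZero n] {T : Finset (Sym2 (Fin n))}
    (hT : IsConvexTree T) {X : Finset (ℝ × ℝ)} (p : Fin n ↪ ℝ × ℝ)
    (hX : ∀ x, x ∈ X ↔ ∃ i, p i = x) (hp : IsConvexLike p) :
    IsPlaneSpanningTree X (T.map p.sym2Map) := by
  obtain ⟨hdiag, hcard, hreach, hcross⟩ := hT
  have hXcard : X.card = n := by
    have : X = Finset.univ.map p := by ext x; simp [hX]
    rw [this, Finset.card_map, Finset.card_univ, Fintype.card_fin]
  have hlift : ∀ {a b : Fin n}, Relation.ReflTransGen (fun a b => s(a, b) ∈ T) a b →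
      Relation.ReflTransGen (fun a b => s(a, b) ∈ T.map p.sym2Map) (p a) (p b) := fun h =>
    h.lift p fun a b hab => Finset.mem_map.2 ⟨s(a, b), hab, rfl⟩
  refine ⟨?_, by rw [Finset.card_map, hcard, hXcard], ?_, ?_⟩
  · intro e he
    obtain ⟨e, heT, rfl⟩ := Finset.mem_map.1 he
    induction e with | _ i j =>
    exact ⟨p i, p j, rfl, p.injective.ne (hdiag _ heT), (hX _).2 ⟨i, rfl⟩, (hX _).2 ⟨j, rfl⟩⟩
  · intro x hx y hy
    obtain ⟨i, rfl⟩ := (hX x).1 hx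
    obtain ⟨j, rfl⟩ := (hX y).1 hy
    have hsymm : ∀ a b, Relation.ReflTransGen (fun a b => s(a, b) ∈ T) a b →
        Relation.ReflTransGen (fun a b => s(a, b) ∈ T) b a := fun a b h =>
      have : Std.Symm fun a b => s(a, b) ∈ T := ⟨fun a b hab => by rwa [Sym2.eq_swap]⟩
      Relation.ReflTransGen.stdSymm.symm a b h
    exact hlift ((hsymm _ _ (hreach i)).trans
      (hreach j))
  · have hsort : ∀ e ∈ T, ∃ i j, i < j ∧ e = s(i, j) := by
      intro e he
      induction e with | _ i j =>
      rcases lt_or_gt_of_ne (hdiag _ he) with h | h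
      · exact ⟨i, j, h, rfl⟩
      · exact ⟨j, i, h, Sym2.eq_swap⟩
    intro e he f hf hef x hxe hxf
    obtain ⟨e, heT, rfl⟩ := Finset.mem_map.1 he
    obtain ⟨f, hfT, rfl⟩ := Finset.mem_map.1 hf
    obtain ⟨i, j, hij, rfl⟩ := hsort e heT
    obtain ⟨k, l, hkl, rfl⟩ := hsort f hfT
    exact hp i j k l hij hkl (fun h => hef (by rw [h]))
      (fun h => hcross i k h.1 j h.2.1 l h.2.2 heT hfT)
      (fun h => hcross k i h.1 l h.2.1 j h.2.2 hfT heT) x hxe hxf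

theorem isRainbowCycleS_map {n : ℕ} [NeZero n] {r L : ℕ} {U : ℕ → Finset (Sym2 (Fin n))}
    (hU : IsConvexRainbowCycle r L U) {X : Finset (ℝ × ℝ)} (p : Fin n ↪ ℝ × ℝ)
    (hX : ∀ x, x ∈ X ↔ ∃ i, p i = x) (hp : IsConvexLike p) :
    IsRainbowCycleS X r L fun i => (U (i % L)).map p.sym2Map := by
  obtain ⟨hL, hclose, hinj, htree, hflip, hcount⟩ := hU
  have hsucc : ∀ i, U ((i + 1) % L) = U (i % L + 1) := by
    intro i
    rw [Nat.add_mod_eq_ite]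
    rcases Nat.lt_or_ge 1 L with h1 | h1
    · rw [Nat.mod_eq_of_lt h1]
      split_ifs with h
      · have := Nat.mod_lt i hL
        obtain h : i % L + 1 = L := by omega
        rw [h, Nat.sub_self, hclose]
      · rfl
    · obtain rfl : L = 1 := by omega
      simp [Nat.mod_one, hclose]
  refine ⟨hL, fun i => by simp only [Nat.add_mod_right], ?_, fun i =>
    isPlaneSpanningTree_map (htree _ (Nat.mod_lt _ hL)) p hX hp, ?_, ?_⟩
  · intro i hi j hj hij
    have := Finset.map_injective _ hij
    rw [Nat.mod_eq_of_lt hi, Nat.mod_eq_of_lt hj] at this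
    exact hinj i hi j hj this
  · intro i
    obtain ⟨e, he, f, -, hf, hstep⟩ := hflip (i % L) (Nat.mod_lt _ hL)
    refine ⟨p.sym2Map e, p.sym2Map f, Finset.mem_map_of_mem _ he, ?_, ?_⟩
    · rwa [Finset.mem_map']
    · simp only [hsucc, hstep, Finset.map_insert, Finset.map_erase]
  · intro x hx y hy hxy
    obtain ⟨i, rfl⟩ := (hX x).1 hx
    obtain ⟨j, rfl⟩ := (hX y).1 hy
    rw [← hcount i j fun h => hxy (by rw [h])]
    congr 1
    refine Finset.filter_congr fun t ht => ?_
    have hs : s(p i, p j) = p.sym2Map s(i, j) := rfl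
    simp only [hsucc]
    rw [hs, Finset.mem_map', Finset.mem_map', Nat.mod_eq_of_lt (Finset.mem_range.1 ht)]

/-! ### Graphs encoded by binary digits -/

/-- The pairs `(i, j)` with `i < j` that satisfy `P`. -/
def orderedEdges {n : ℕ} (P : Fin n → Fin n → Bool) : Finset (Fin n × Fin n) :=
  Finset.univ.filter fun x => x.1 < x.2 ∧ P x.1 x.2

/-- The edges `s(i, j)` with `i < j` for which `P i j` holds. -/
def edgesOf {n : ℕ} (P : Fin n → Fin n → Bool) : Finset (Sym2 (Fin n)) :=
  (orderedEdges P).image fun x => s(x.1, x.2)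

theorem mem_edgesOf {n : ℕ} {P : Fin n → Fin n → Bool} {e : Sym2 (Fin n)} :
    e ∈ edgesOf P ↔ ∃ i j, i < j ∧ P i j ∧ s(i, j) = e := by
  simp [edgesOf, orderedEdges, and_assoc]

theorem mk_mem_edgesOf {n : ℕ} {P : Fin n → Fin n → Bool} {i j : Fin n} (h : i < j) :
    s(i, j) ∈ edgesOf P ↔ P i j := by
  rw [mem_edgesOf]
  constructor
  · rintro ⟨a, b, hab, hP, he⟩
    rcases Sym2.eq_iff.1 he with ⟨rfl, rfl⟩ | ⟨rfl, rfl⟩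
    · exact hP
    · exact absurd h hab.not_gt
  · exact fun hP => ⟨i, j, h, hP, rfl⟩

theorem card_edgesOf {n : ℕ} (P : Fin n → Fin n → Bool) :
    (edgesOf P).card = (orderedEdges P).card := by
  refine Finset.card_image_of_injOn ?_
  rintro ⟨a, b⟩ hx ⟨c, d⟩ hy h
  simp only [orderedEdges, Finset.coe_filter, Finset.mem_univ, true_and, Set.mem_ofPred_eq] at hx hy
  rcases Sym2.eq_iff.1 h with ⟨rfl, rfl⟩ | ⟨rfl, rfl⟩
  · rfl
  · exact absurd hx.1 hy.1.not_gt

theorem edgesOf_sdiff {n : ℕ} (P Q : Fin n → Fin n → Bool) :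
    edgesOf P \ edgesOf Q = edgesOf fun i j => P i j && !Q i j := by
  ext e
  simp only [Finset.mem_sdiff, mem_edgesOf (P := P), mem_edgesOf (P := fun i j => P i j && !Q i j)]
  constructor
  · rintro ⟨⟨i, j, hij, hP, rfl⟩, hQ⟩
    rw [mk_mem_edgesOf hij] at hQ
    exact ⟨i, j, hij, by simp [hP, hQ], rfl⟩
  · rintro ⟨i, j, hij, h, rfl⟩
    rw [Bool.and_eq_true, Bool.not_eq_true'] at h
    exact ⟨⟨i, j, hij, h.1, rfl⟩, by simp [mk_mem_edgesOf hij, h.2]⟩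

/-- The vertices at distance at most `d` from `0` in the graph `edgesOf P`. -/
def reach {n : ℕ} [NeZero n] (P : Fin n → Fin n → Bool) : ℕ → Finset (Fin n)
  | 0 => {0}
  | d + 1 => Finset.univ.filter fun j => j ∈ reach P d ∨
      ∃ i ∈ reach P d, (i < j ∧ P i j) ∨ (j < i ∧ P j i)

theorem reflTransGen_of_mem_reach {n : ℕ} [NeZero n] {P : Fin n → Fin n → Bool} {d : ℕ}
    {j : Fin n} (h : j ∈ reach P d) :
    Relation.ReflTransGen (fun a b => s(a, b) ∈ edgesOf P) 0 j := by
  induction d generalizing j with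
  | zero =>
    rw [reach, Finset.mem_singleton] at h
    rw [h]
  | succ d ih =>
    simp only [reach, Finset.mem_filter, Finset.mem_univ, true_and] at h
    rcases h with h | ⟨i, hi, ⟨hij, hP⟩ | ⟨hji, hP⟩⟩
    · exact ih h
    · exact (ih hi).tail ((mk_mem_edgesOf hij).2 hP)
    · refine (ih hi).tail ?_
      rw [Sym2.eq_swap]
      exact (mk_mem_edgesOf hji).2 hP

/-- The digit of `N` that belongs to the pair `i < j`, the pairs being numbered in the
colexicographic order. -/
def edgeBit (n N : ℕ) (i j : Fin n) : Bool :=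
  N.testBit ((i : ℕ) + (j : ℕ).choose 2)

/-- The decidable version of `IsConvexTree`. -/
abbrev IsBitTree (n : ℕ) [NeZero n] (N : ℕ) : Prop :=
  (orderedEdges (edgeBit n N)).card = n - 1 ∧ (∀ j, j ∈ reach (edgeBit n N) n) ∧
    ∀ i k : Fin n, i < k → ∀ j, k < j → ∀ l, j < l → edgeBit n N i j → ¬ edgeBit n N k l

theorem IsBitTree.isConvexTree {n N : ℕ} [NeZero n] (h : IsBitTree n N) :
    IsConvexTree (edgesOf (edgeBit n N)) := by
  refine ⟨?_, (card_edgesOf _).trans h.1, fun j => reflTransGen_of_mem_reach (h.2.1 j), ?_⟩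
  · intro e he
    obtain ⟨i, j, hij, -, rfl⟩ := mem_edgesOf.1 he
    exact hij.ne
  · intro i k hik j hkj l hjl
    rw [mk_mem_edgesOf (hik.trans hkj), mk_mem_edgesOf (hkj.trans hjl)]
    exact h.2.2 i k hik j hkj l hjl

theorem exists_flip_of_card_sdiff {α : Type*} [DecidableEq α] {S T : Finset α}
    (hcard : S.card = T.card) (h : (S \ T).card = 1) :
    ∃ e ∈ S, ∃ f ∈ T, f ∉ S ∧ T = insert f (S.erase e) := by
  obtain ⟨e, he⟩ := Finset.card_eq_one.1 h
  obtain ⟨f, hf⟩ := Finset.card_eq_one.1 ((Finset.card_sdiff_comm hcard.symm).trans h)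
  simp only [Finset.ext_iff, Finset.mem_sdiff, Finset.mem_singleton] at he hf
  refine ⟨e, ((he e).2 rfl).1, f, ((hf f).2 rfl).1, ((hf f).2 rfl).2, ?_⟩
  ext x
  grind

/-- A list of numbers whose binary digits encode the trees of a rainbow cycle for convex
position. -/
structure IsBitCycle (n : ℕ) [NeZero n] (r : ℕ) (l : List ℕ) : Prop where
  length_pos : 0 < l.length
  distinct : l.Pairwise fun N N' => ∃ i j : Fin n, i < j ∧ edgeBit n N i j ≠ edgeBit n N' i j
  tree : ∀ N ∈ l, IsBitTree n N
  flip : ∀ t < l.length,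
    (orderedEdges fun i j => edgeBit n (l.getD t 0) i j &&
      !edgeBit n (l.getD ((t + 1) % l.length) 0) i j).card = 1
  count : ∀ i j : Fin n, i < j → ((Finset.range l.length).filter fun t =>
    edgeBit n (l.getD ((t + 1) % l.length) 0) i j ∧ ¬ edgeBit n (l.getD t 0) i j).card = r

theorem IsBitCycle.isConvexRainbowCycle {n r L : ℕ} [NeZero n] {l : List ℕ}
    (h : IsBitCycle n r l) (hL : l.length = L) :
    IsConvexRainbowCycle r L fun t => edgesOf (edgeBit n (l.getD (t % L) 0)) := by
  subst hL
  have hmem : ∀ t, l.getD (t % l.length) 0 ∈ l := fun t => by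
    rw [List.getD_eq_getElem _ _ (Nat.mod_lt t h.length_pos)]
    exact List.getElem_mem _
  have hne : ∀ t t', t < t' → t' < l.length →
      edgesOf (edgeBit n (l.getD t 0)) ≠ edgesOf (edgeBit n (l.getD t' 0)) := by
    intro t t' htt ht' he
    rw [List.getD_eq_getElem _ _ ht', List.getD_eq_getElem _ _ (htt.trans ht')] at he
    obtain ⟨i, j, hij, hb⟩ := List.pairwise_iff_getElem.1 h.distinct t t' _ ht' htt
    apply hb
    rw [Bool.eq_iff_iff, ← mk_mem_edgesOf hij, ← mk_mem_edgesOf hij, he]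
  refine ⟨h.length_pos, by simp only [Nat.mod_self, Nat.zero_mod], ?_,
    fun t _ => (h.tree _ (hmem t)).isConvexTree, ?_, ?_⟩
  · intro t ht t' ht' he
    simp only [Nat.mod_eq_of_lt ht, Nat.mod_eq_of_lt ht'] at he
    by_contra hcon
    rcases lt_or_gt_of_ne hcon with hlt | hlt
    · exact hne t t' hlt ht' he
    · exact hne t' t hlt ht he.symm
  · intro t ht
    refine exists_flip_of_card_sdiff ?_ ?_
    · rw [card_edgesOf, card_edgesOf, (h.tree _ (hmem t)).1, (h.tree _ (hmem (t + 1))).1]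
    · rw [edgesOf_sdiff, card_edgesOf, Nat.mod_eq_of_lt ht]
      exact h.flip t ht
  · have hlt : ∀ i j : Fin n, i < j → ((Finset.range l.length).filter fun t =>
        s(i, j) ∈ edgesOf (edgeBit n (l.getD ((t + 1) % l.length) 0)) ∧
        s(i, j) ∉ edgesOf (edgeBit n (l.getD (t % l.length) 0))).card = r := by
      intro i j hij
      rw [← h.count i j hij]
      congr 1
      refine Finset.filter_congr fun t ht => ?_
      rw [mk_mem_edgesOf hij, mk_mem_edgesOf hij, Nat.mod_eq_of_lt (Finset.mem_range.1 ht)]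
    intro i j hij
    rcases lt_or_gt_of_ne hij with hij | hij
    · exact hlt i j hij
    · rw [Sym2.eq_swap]
      exact hlt j i hij

/-- A 2-rainbow cycle for four points in convex position. -/
def fourPointCycle : List ℕ :=
  [11, 35, 41, 49, 21, 37, 38, 44, 56, 28, 13, 14]

theorem isBitCycle_fourPointCycle : IsBitCycle 4 2 fourPointCycle where
  length_pos := by decide +kernel
  distinct := by decide +kernel
  tree := by decide +kernel
  flip := by decide +kernel
  count := by decide +kernel

/-- A 2-rainbow cycle for five points in convex position. -/
def fivePointCycleTwo : List ℕ :=
  [75, 523, 579, 833, 960, 480, 736, 624, 568, 540, 556, 550, 294, 291, 293, 165, 149, 212,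
     85, 77]

theorem isBitCycle_fivePointCycleTwo : IsBitCycle 5 2 fivePointCycleTwo where
  length_pos := by decide +kernel
  distinct := by decide +kernel
  tree := by decide +kernel
  flip := by decide +kernel
  count := by decide +kernel

/-- A 3-rainbow cycle for five points in convex position. -/
def fivePointCycleThree : List ℕ :=
  [75, 523, 579, 547, 553, 561, 568, 540, 556, 525, 533, 645, 149, 212, 85, 596, 708, 836,
     960, 480, 736, 228, 356, 102, 294, 291, 293, 353, 99, 105]

theorem isBitCycle_fivePointCycleThree : IsBitCycle 5 3 fivePointCycleThree where
  length_pos := by decide +kernel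
  distinct := by decide +kernel
  tree := by decide +kernel
  flip := by decide +kernel
  count := by decide +kernel

/-- A 4-rainbow cycle for five points in convex position. -/
def fivePointCycleFour : List ℕ :=
  [75, 523, 579, 99, 105, 113, 101, 165, 149, 212, 85, 533, 645, 773, 549, 550, 294, 291, 293,
     356, 102, 108, 612, 624, 568, 540, 556, 553, 561, 673, 609, 833, 960, 480, 736, 708, 836,
     582, 581, 77]

theorem isBitCycle_fivePointCycleFour : IsBitCycle 5 4 fivePointCycleFour where
  length_pos := by decide +kernel
  distinct := by decide +kernel
  tree := by decide +kernel
  flip := by decide +kernel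
  count := by decide +kernel

/-- For every set `X` of exactly 4 points in general position, the flip graph
of plane spanning trees on `X` contains a 2-rainbow cycle; and for every set
`X` of exactly 5 points in general position and every `r ∈ {2,3,4}`, the flip
graph of plane spanning trees on `X` contains an `r`-rainbow cycle. -/
theorem plane_trees_small_rainbow_cycles :
    (∀ X : Finset (ℝ × ℝ), X.card = 4 → GeneralPosition X →
      ∃ V : ℕ → Finset (Sym2 (ℝ × ℝ)),
        IsRainbowCycleS X 2 (2 * X.card.choose 2) V) ∧
    (∀ X : Finset (ℝ × ℝ), X.card = 5 → GeneralPosition X →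
      ∀ r ∈ ({2, 3, 4} : Finset ℕ),
        ∃ V : ℕ → Finset (Sym2 (ℝ × ℝ)),
          IsRainbowCycleS X r (r * X.card.choose 2) V) := by
  constructor
  · intro X hcard hX
    obtain ⟨p, hinj, hpX, hp⟩ := exists_isConvexLike_four hcard hX
    rw [hcard]
    exact ⟨_, isRainbowCycleS_map (isBitCycle_fourPointCycle.isConvexRainbowCycle (by decide))
        ⟨p, hinj⟩ hpX hp⟩
  · intro X hcard hX r hr
    obtain ⟨p, hinj, hpX, hp⟩ := exists_isConvexLike_five hcard hX
    rw [hcard]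
    simp only [Finset.mem_insert, Finset.mem_singleton] at hr
    rcases hr with rfl | rfl | rfl
    · exact ⟨_, isRainbowCycleS_map (isBitCycle_fivePointCycleTwo.isConvexRainbowCycle (by decide))
        ⟨p, hinj⟩ hpX hp⟩
    · exact ⟨_, isRainbowCycleS_map (isBitCycle_fivePointCycleThree.isConvexRainbowCycle (by decide))
        ⟨p, hinj⟩ hpX hp⟩
    · exact ⟨_, isRainbowCycleS_map (isBitCycle_fivePointCycleFour.isConvexRainbowCycle (by decide))
        ⟨p, hinj⟩ hpX hp⟩
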